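/- arXiv:1907.03825 — 2 statements merged into one kernel-verified Lean document; each statement's English description precedes it below -/
import Mathlib

section
/- Let f : [a,b] → X have the property S*M on [a,b] and let Z₂ = { t₂ ∈ [a₂,b₂] : the section f_{t₂} does not have the property S*M on [a₁,b₁] }. Then the indicator function 𝟙_{Z₂} is McShane integrable on [a₂,b₂] with (M)∫_{[a₂,b₂]} 𝟙_{Z₂} = 0. -/
open Set MeasureTheory

variable {E : Type*} [MeasureSpace E] [PseudoMetricSpace E] [Preorder E]
variable {X : Type*} [NormedAddCommGroup X] [NormedSpace ℝ X]

/-- The closed interval of a tagged item `(t, p, q)` is `[p, q]` (the tag is `t`). -/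
def itemBox (x : E × E × E) : Set E := Set.Icc x.2.1 x.2.2

/-- `[p,q]` is a closed non-degenerate subinterval of `K`. -/
def IsSubinterval (K : Set E) (p q : E) : Prop :=
  Set.Icc p q ⊆ K ∧ (interior (Set.Icc p q)).Nonempty

/-- `P` is an `𝓜`-partition of `K`: a finite collection of tagged pairwise
non-overlapping closed non-degenerate subintervals of `K` covering `K`, with tags in `K`. -/
def IsMPartition (K : Set E) (P : Finset (E × E × E)) : Prop :=
  (∀ x ∈ P, x.1 ∈ K ∧ IsSubinterval K x.2.1 x.2.2) ∧
  (∀ x ∈ P, ∀ y ∈ P, x ≠ y → interior (itemBox x) ∩ interior (itemBox y) = ∅) ∧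
  (⋃ x ∈ P, itemBox x) = K

/-- `𝓗𝓚`-partition: an `𝓜`-partition each of whose tags belongs to its interval. -/
def IsHKPartition (K : Set E) (P : Finset (E × E × E)) : Prop :=
  IsMPartition K P ∧ ∀ x ∈ P, x.1 ∈ itemBox x

/-- A gauge on `K`: positive on `K`. -/
def IsGauge (K : Set E) (δ : E → ℝ) : Prop := ∀ t ∈ K, 0 < δ t

/-- A tagged partition is `δ`-fine if each interval lies in the open ball
around its tag of radius `δ(tag)`. -/
def IsFine (δ : E → ℝ) (P : Finset (E × E × E)) : Prop :=
  ∀ x ∈ P, itemBox x ⊆ Metric.ball x.1 (δ x.1)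

/-- `f` is McShane integrable on `K` with integral `v`. -/
def HasMcShaneIntegral (K : Set E) (f : E → X) (v : X) : Prop :=
  ∀ ε > 0, ∃ δ : E → ℝ, IsGauge K δ ∧
    ∀ P : Finset (E × E × E), IsMPartition K P → IsFine δ P →
      ‖(∑ x ∈ P, (volume (itemBox x)).toReal • f x.1) - v‖ < ε

/-- `f` is Henstock–Kurzweil integrable on `K` with integral `v`. -/
def HasHKIntegral (K : Set E) (f : E → X) (v : X) : Prop :=
  ∀ ε > 0, ∃ δ : E → ℝ, IsGauge K δ ∧
    ∀ P : Finset (E × E × E), IsHKPartition K P → IsFine δ P →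
      ‖(∑ x ∈ P, (volume (itemBox x)).toReal • f x.1) - v‖ < ε

/-- An additive interval function on the non-degenerate closed subintervals of `K`
(an interval is recorded by its pair of corners). -/
def IsAdditiveIntervalFun (K : Set E) (F : E × E → X) : Prop :=
  ∀ p q r s u w : E, IsSubinterval K p q → IsSubinterval K r s → IsSubinterval K u w →
    interior (Set.Icc p q) ∩ interior (Set.Icc r s) = ∅ →
    Set.Icc p q ∪ Set.Icc r s = Set.Icc u w →
    F (u, w) = F (p, q) + F (r, s)

/-- `f` is strongly McShane integrable on `[a,b]` with `(M)∫_{[a,b]} f = v`. -/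
def HasStrongMcShaneIntegral (a b : E) (f : E → X) (v : X) : Prop :=
  ∃ F : E × E → X, IsAdditiveIntervalFun (Set.Icc a b) F ∧ F (a, b) = v ∧
    ∀ ε > 0, ∃ δ : E → ℝ, IsGauge (Set.Icc a b) δ ∧
      ∀ P : Finset (E × E × E), IsMPartition (Set.Icc a b) P → IsFine δ P →
        ∑ x ∈ P, ‖(volume (itemBox x)).toReal • f x.1 - F (x.2.1, x.2.2)‖ < ε

/-- `f` is strongly Henstock–Kurzweil integrable on `[a,b]` with `(HK)∫_{[a,b]} f = v`. -/
def HasStrongHKIntegral (a b : E) (f : E → X) (v : X) : Prop :=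
  ∃ F : E × E → X, IsAdditiveIntervalFun (Set.Icc a b) F ∧ F (a, b) = v ∧
    ∀ ε > 0, ∃ δ : E → ℝ, IsGauge (Set.Icc a b) δ ∧
      ∀ P : Finset (E × E × E), IsHKPartition (Set.Icc a b) P → IsFine δ P →
        ∑ x ∈ P, ‖(volume (itemBox x)).toReal • f x.1 - F (x.2.1, x.2.2)‖ < ε

/-- Property `𝓢*𝓜` on `[a,b]`. -/
def PropSM (a b : E) (f : E → X) : Prop :=
  ∀ ε > 0, ∃ δ : E → ℝ, IsGauge (Set.Icc a b) δ ∧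
    ∀ P Q : Finset (E × E × E),
      IsMPartition (Set.Icc a b) P → IsFine δ P →
      IsMPartition (Set.Icc a b) Q → IsFine δ Q →
      ∑ x ∈ P, ∑ y ∈ Q, ‖f x.1 - f y.1‖ * (volume (itemBox x ∩ itemBox y)).toReal < ε

/-- Property `𝓢*𝓗𝓚` on `[a,b]`. -/
def PropSHK (a b : E) (f : E → X) : Prop :=
  ∀ ε > 0, ∃ δ : E → ℝ, IsGauge (Set.Icc a b) δ ∧
    ∀ P Q : Finset (E × E × E),
      IsHKPartition (Set.Icc a b) P → IsFine δ P →
      IsHKPartition (Set.Icc a b) Q → IsFine δ Q →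
      ∑ x ∈ P, ∑ y ∈ Q, ‖f x.1 - f y.1‖ * (volume (itemBox x ∩ itemBox y)).toReal < ε

/-- A finite family of positive reals has a positive lower bound. -/
lemma Finset.exists_pos_forall_le {ι : Type*} (s : Finset ι) (g : ι → ℝ)
    (hg : ∀ i ∈ s, 0 < g i) : ∃ d > 0, ∀ i ∈ s, d ≤ g i := by
  classical
  induction s using Finset.induction_on with
  | empty => exact ⟨1, one_pos, by simp⟩
  | insert a s _ ih =>
    obtain ⟨d, hd, h⟩ := ih fun i hi => hg i (Finset.mem_insert_of_mem hi)
    refine ⟨min d (g a), lt_min hd (hg a (Finset.mem_insert_self a s)), fun i hi => ?_⟩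
    rcases Finset.mem_insert.mp hi with rfl | hi
    · exact min_le_right _ _
    · exact (min_le_left _ _).trans (h i hi)

lemma Monotone.biUnion_range_Icc_map_succ {c : ℕ → ℝ} (hc : Monotone c) {N : ℕ} (hN : 0 < N) :
    ⋃ i ∈ Finset.range N, Icc (c i) (c (i + 1)) = Icc (c 0) (c N) := by
  induction N, hN using Nat.le_induction with
  | base => simp
  | succ N _ ih =>
    rw [Finset.range_add_one, Finset.set_biUnion_insert, ih, union_comm,
      Icc_union_Icc_eq_Icc (hc (Nat.zero_le N)) (hc (Nat.le_succ N))]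

/-- A uniform grid can be tagged so as to be fine; if the gauge is bounded below on `S`,
the cells meeting `S` can moreover be given tags in `S`. -/
lemma exists_isMPartition_isFine_cover {a b : ℝ} (hab : a < b) {δ : ℝ → ℝ}
    (hδ : IsGauge (Icc a b) δ) {S : Set ℝ} (hS : S ⊆ Icc a b) {r : ℝ} (hr : 0 < r)
    (hrS : ∀ t ∈ S, r ≤ δ t) :
    ∃ P : Finset (ℝ × ℝ × ℝ), IsMPartition (Icc a b) P ∧ IsFine δ P ∧
      ∀ s ∈ S, ∃ x ∈ P, x.1 ∈ S ∧ s ∈ itemBox x := by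
  classical
  obtain ⟨η, hη, hball⟩ := lebesgue_number_lemma_of_metric (s := Icc a b)
    (c := fun t : Icc a b => Metric.ball (t : ℝ) (δ t)) isCompact_Icc
    (fun _ => Metric.isOpen_ball)
    (fun t ht => mem_iUnion.mpr ⟨⟨t, ht⟩, Metric.mem_ball_self (hδ t ht)⟩)
  obtain ⟨N, hN⟩ := exists_nat_gt ((b - a) / min η r)
  have hm : 0 < min η r := lt_min hη hr
  have hN0 : (0 : ℝ) < N := (div_pos (sub_pos.mpr hab) hm).trans hN
  set h : ℝ := (b - a) / N with h_def
  have hh : 0 < h := div_pos (sub_pos.mpr hab) hN0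
  have hhm : h < min η r := by
    rw [h_def, div_lt_iff₀ hN0, mul_comm]
    exact (div_lt_iff₀ hm).mp hN
  set c : ℕ → ℝ := fun i => a + i * h with c_def
  have hsucc (i : ℕ) : c (i + 1) = c i + h := by simp only [c_def]; push_cast; ring
  have hc : Monotone c := monotone_nat_of_le_succ fun i => by rw [hsucc]; linarith
  have hunion : ⋃ i ∈ Finset.range N, Icc (c i) (c (i + 1)) = Icc a b := by
    rw [hc.biUnion_range_Icc_map_succ (by exact_mod_cast hN0)]
    congr 1
    · simp [c_def]
    · simp only [c_def, h_def]; field_simp; ring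
  have hsub {i : ℕ} (hi : i ∈ Finset.range N) : Icc (c i) (c (i + 1)) ⊆ Icc a b :=
    hunion ▸ subset_biUnion_of_mem (u := fun i => Icc (c i) (c (i + 1))) (Finset.mem_coe.mpr hi)
  have htag (i : ℕ) : ∃ t, i ∈ Finset.range N → t ∈ Icc a b ∧
      Icc (c i) (c (i + 1)) ⊆ Metric.ball t (δ t) ∧
      ∀ s ∈ S, s ∈ Icc (c i) (c (i + 1)) → t ∈ S := by
    by_cases hi : i ∈ Finset.range N
    · by_cases hmeet : ∃ s ∈ S, s ∈ Icc (c i) (c (i + 1))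
      · obtain ⟨s, hs, hsI⟩ := hmeet
        refine ⟨s, fun _ => ⟨hS hs, fun u hu => ?_, fun _ _ _ => hs⟩⟩
        rw [Metric.mem_ball, Real.dist_eq, abs_lt]
        have h1 := hrS s hs
        have h2 := min_le_right η r
        rw [hsucc] at hsI hu
        constructor <;> linarith [hsI.1, hsI.2, hu.1, hu.2]
      · obtain ⟨t, ht⟩ := hball (c i) (hsub hi (left_mem_Icc.mpr (hc i.le_succ)))
        refine ⟨t, fun _ => ⟨t.2, fun u hu => ht ?_, fun s hs hsI => (hmeet ⟨s, hs, hsI⟩).elim⟩⟩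
        rw [Metric.mem_ball, Real.dist_eq, abs_lt]
        have h2 := min_le_left η r
        rw [hsucc] at hu
        constructor <;> linarith [hu.1, hu.2]
    · exact ⟨0, fun h => (hi h).elim⟩
  choose τ hτ using htag
  refine ⟨(Finset.range N).image fun i => (τ i, c i, c (i + 1)), ⟨?_, ?_, ?_⟩, ?_, ?_⟩
  · simp only [Finset.mem_image]
    rintro _ ⟨i, hi, rfl⟩
    refine ⟨(hτ i hi).1, hsub hi, ?_⟩
    simp only [interior_Icc, nonempty_Ioo, hsucc]
    linarith
  · simp only [Finset.mem_image]
    rintro _ ⟨i, hi, rfl⟩ _ ⟨j, hj, rfl⟩ hij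
    simp only [itemBox, interior_Icc]
    exact (hc.pairwise_disjoint_on_Ioo_succ (fun h => hij (by rw [h]))).inter_eq
  · rw [Finset.set_biUnion_finset_image]
    exact hunion
  · simp only [IsFine, Finset.mem_image]
    rintro _ ⟨i, hi, rfl⟩
    exact (hτ i hi).2.1
  · intro s hs
    have := hS hs
    rw [← hunion] at this
    obtain ⟨i, hi, hsi⟩ := mem_iUnion₂.mp this
    exact ⟨_, Finset.mem_image_of_mem _ hi, (hτ i hi).2.2 s hs hsi, hsi⟩

lemma exists_isMPartition_isFine {a b : ℝ} (hab : a < b) {δ : ℝ → ℝ}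
    (hδ : IsGauge (Icc a b) δ) :
    ∃ P : Finset (ℝ × ℝ × ℝ), IsMPartition (Icc a b) P ∧ IsFine δ P := by
  obtain ⟨P, hP, hPδ, -⟩ := exists_isMPartition_isFine_cover hab hδ (empty_subset _) one_pos
    (by simp)
  exact ⟨P, hP, hPδ⟩

/-- The indicator of a Lebesgue null set has McShane integral zero. -/
lemma hasMcShaneIntegral_indicator_of_null {K Z : Set ℝ} (hZ : volume Z = 0) :
    HasMcShaneIntegral K (Z.indicator fun _ => (1 : ℝ)) 0 := by
  classical
  intro ε hε
  obtain ⟨U, hZU, hU, hUε⟩ := Z.exists_isOpen_lt_of_lt (μ := volume) (ENNReal.ofReal ε)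
    (by rw [hZ]; exact ENNReal.ofReal_pos.mpr hε)
  have hδ (t : ℝ) : ∃ d > 0, t ∈ Z → Metric.ball t d ⊆ U := by
    by_cases ht : t ∈ Z
    · obtain ⟨d, hd, h⟩ := Metric.isOpen_iff.mp hU t (hZU ht)
      exact ⟨d, hd, fun _ => h⟩
    · exact ⟨1, one_pos, fun h => (ht h).elim⟩
  choose δ hδ0 hδ using hδ
  refine ⟨δ, fun t _ => hδ0 t, fun P hP hPδ => ?_⟩
  have hsum : ∑ x ∈ P, (volume (itemBox x)).toReal • Z.indicator (fun _ => (1 : ℝ)) x.1 =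
      ∑ x ∈ P with x.1 ∈ Z, (volume (itemBox x)).toReal := by
    simp [Finset.sum_filter, indicator_apply]
  rw [sub_zero, hsum, Real.norm_of_nonneg (Finset.sum_nonneg fun _ _ => ENNReal.toReal_nonneg)]
  have hvol : ∑ x ∈ P with x.1 ∈ Z, volume (itemBox x) ≤ volume U := by
    calc ∑ x ∈ P with x.1 ∈ Z, volume (itemBox x)
        = ∑ x ∈ P with x.1 ∈ Z, volume (interior (itemBox x)) := by
          simp [itemBox, Real.volume_Icc, Real.volume_Ioo]
      _ = volume (⋃ x ∈ P.filter (fun x => x.1 ∈ Z), interior (itemBox x)) := by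
          refine (measure_biUnion_finset (fun x hx y hy hxy => ?_)
            fun _ _ => isOpen_interior.measurableSet).symm
          exact disjoint_iff_inter_eq_empty.mpr (hP.2.1 x (Finset.mem_filter.mp hx).1 y
            (Finset.mem_filter.mp hy).1 hxy)
      _ ≤ volume U := by
          refine measure_mono (iUnion₂_subset fun x hx => ?_)
          obtain ⟨hxP, hxZ⟩ := Finset.mem_filter.mp hx
          exact interior_subset.trans ((hPδ x hxP).trans (hδ _ hxZ))
  rw [← ENNReal.toReal_sum fun x _ => by simp [itemBox, Real.volume_Icc]]
  exact ENNReal.toReal_lt_of_lt_ofReal (hvol.trans_lt hUε)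

/-- The two-dimensional tagged item with sides `x` and `y`. -/
def prodItem (x y : ℝ × ℝ × ℝ) : (ℝ × ℝ) × (ℝ × ℝ) × (ℝ × ℝ) :=
  ((x.1, y.1), (x.2.1, y.2.1), (x.2.2, y.2.2))

lemma prodItem_inj {x y x' y' : ℝ × ℝ × ℝ} :
    prodItem x y = prodItem x' y' ↔ x = x' ∧ y = y' := by
  simp only [prodItem, Prod.ext_iff]
  tauto

lemma itemBox_prodItem (x y : ℝ × ℝ × ℝ) : itemBox (prodItem x y) = itemBox x ×ˢ itemBox y :=
  Icc_prod_eq _ _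

lemma volume_itemBox_prodItem_inter (x y x' y' : ℝ × ℝ × ℝ) :
    (volume (itemBox (prodItem x y) ∩ itemBox (prodItem x' y'))).toReal =
      (volume (itemBox x ∩ itemBox x')).toReal * (volume (itemBox y ∩ itemBox y')).toReal := by
  rw [itemBox_prodItem, itemBox_prodItem, prod_inter_prod, Measure.volume_eq_prod,
    Measure.prod_prod, ENNReal.toReal_mul]

open Classical in
/-- The product of a partition `P₂` of the second side with partitions `P t` of the first side
chosen for each tag `t` of `P₂`. -/
noncomputable def fiberProd (P : ℝ → Finset (ℝ × ℝ × ℝ)) (P₂ : Finset (ℝ × ℝ × ℝ)) :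
    Finset ((ℝ × ℝ) × (ℝ × ℝ) × (ℝ × ℝ)) :=
  (P₂.sigma fun y => P y.1).image fun z => prodItem z.2 z.1

lemma mem_fiberProd {P : ℝ → Finset (ℝ × ℝ × ℝ)} {P₂ : Finset (ℝ × ℝ × ℝ)}
    {z : (ℝ × ℝ) × (ℝ × ℝ) × (ℝ × ℝ)} :
    z ∈ fiberProd P P₂ ↔ ∃ y ∈ P₂, ∃ x ∈ P y.1, prodItem x y = z := by
  simp only [fiberProd, Finset.mem_image, Finset.mem_sigma]
  constructor
  · rintro ⟨⟨y, x⟩, ⟨hy, hx⟩, rfl⟩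
    exact ⟨y, hy, x, hx, rfl⟩
  · rintro ⟨y, hy, x, hx, rfl⟩
    exact ⟨⟨y, x⟩, ⟨hy, hx⟩, rfl⟩

lemma sum_fiberProd (P : ℝ → Finset (ℝ × ℝ × ℝ)) (P₂ : Finset (ℝ × ℝ × ℝ))
    (F : (ℝ × ℝ) × (ℝ × ℝ) × (ℝ × ℝ) → ℝ) :
    ∑ z ∈ fiberProd P P₂, F z = ∑ y ∈ P₂, ∑ x ∈ P y.1, F (prodItem x y) := by
  rw [fiberProd, Finset.sum_image, Finset.sum_sigma]
  rintro ⟨y, x⟩ - ⟨y', x'⟩ - h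
  obtain ⟨rfl, rfl⟩ := prodItem_inj.mp h
  rfl

lemma isMPartition_fiberProd {a₁ b₁ a₂ b₂ : ℝ} {P : ℝ → Finset (ℝ × ℝ × ℝ)}
    (hP : ∀ t ∈ Icc a₂ b₂, IsMPartition (Icc a₁ b₁) (P t)) {P₂ : Finset (ℝ × ℝ × ℝ)}
    (hP₂ : IsMPartition (Icc a₂ b₂) P₂) :
    IsMPartition (Icc ((a₁, a₂) : ℝ × ℝ) (b₁, b₂)) (fiberProd P P₂) := by
  have hPy {y : ℝ × ℝ × ℝ} (hy : y ∈ P₂) := hP y.1 (hP₂.1 y hy).1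
  rw [← Icc_prod_Icc]
  refine ⟨?_, ?_, ?_⟩
  · intro z hz
    obtain ⟨y, hy, x, hx, rfl⟩ := mem_fiberProd.mp hz
    have hx' := (hPy hy).1 x hx
    have hy' := hP₂.1 y hy
    refine ⟨⟨hx'.1, hy'.1⟩, ?_⟩
    change itemBox (prodItem x y) ⊆ _ ∧ (interior (itemBox (prodItem x y))).Nonempty
    rw [itemBox_prodItem, interior_prod_eq]
    exact ⟨prod_mono hx'.2.1 hy'.2.1, hx'.2.2.prod hy'.2.2⟩
  · intro z hz z' hz' hne
    obtain ⟨y, hy, x, hx, rfl⟩ := mem_fiberProd.mp hz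
    obtain ⟨y', hy', x', hx', rfl⟩ := mem_fiberProd.mp hz'
    rw [itemBox_prodItem, itemBox_prodItem, interior_prod_eq, interior_prod_eq, prod_inter_prod]
    by_cases hyy : y = y'
    · subst hyy
      rw [(hPy hy).2.1 x hx x' hx' fun h => hne (by rw [h]), empty_prod]
    · rw [hP₂.2.1 y hy y' hy' hyy, prod_empty]
  · ext ⟨s, t⟩
    simp only [mem_iUnion, mem_prod]
    constructor
    · rintro ⟨z, hz, hst⟩
      obtain ⟨y, hy, x, hx, rfl⟩ := mem_fiberProd.mp hz
      rw [itemBox_prodItem] at hst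
      exact ⟨((hPy hy).1 x hx).2.1 hst.1, (hP₂.1 y hy).2.1 hst.2⟩
    · rintro ⟨hs, ht⟩
      rw [← hP₂.2.2] at ht
      obtain ⟨y, hy, hty⟩ := mem_iUnion₂.mp ht
      rw [← (hPy hy).2.2] at hs
      obtain ⟨x, hx, hsx⟩ := mem_iUnion₂.mp hs
      exact ⟨prodItem x y, mem_fiberProd.mpr ⟨y, hy, x, hx, rfl⟩,
        itemBox_prodItem x y ▸ ⟨hsx, hty⟩⟩

lemma isFine_fiberProd {δ : ℝ × ℝ → ℝ} {δ₂ : ℝ → ℝ} {P : ℝ → Finset (ℝ × ℝ × ℝ)}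
    {P₂ : Finset (ℝ × ℝ × ℝ)} (hP₂ : IsFine δ₂ P₂)
    (hP : ∀ y ∈ P₂, IsFine (fun s => δ (s, y.1)) (P y.1))
    (hδ : ∀ y ∈ P₂, ∀ x ∈ P y.1, δ₂ y.1 ≤ δ (x.1, y.1)) : IsFine δ (fiberProd P P₂) := by
  intro z hz
  obtain ⟨y, hy, x, hx, rfl⟩ := mem_fiberProd.mp hz
  rw [itemBox_prodItem]
  change _ ⊆ Metric.ball (x.1, y.1) (δ (x.1, y.1))
  rw [← ball_prod_same]
  exact prod_mono (hP y hy x hx) ((hP₂ y hy).trans (Metric.ball_subset_ball (hδ y hy x hx)))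

/-- The double sum in property `𝓢*𝓜` for a pair of tagged families on the line. -/
noncomputable def oscSum {Y : Type*} [NormedAddCommGroup Y] (g : ℝ → Y)
    (P Q : Finset (ℝ × ℝ × ℝ)) : ℝ :=
  ∑ x ∈ P, ∑ y ∈ Q, ‖g x.1 - g y.1‖ * (volume (itemBox x ∩ itemBox y)).toReal

lemma oscSum_nonneg {Y : Type*} [NormedAddCommGroup Y] (g : ℝ → Y)
    (P Q : Finset (ℝ × ℝ × ℝ)) : 0 ≤ oscSum g P Q :=
  Finset.sum_nonneg fun _ _ => Finset.sum_nonneg fun _ _ =>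
    mul_nonneg (norm_nonneg _) ENNReal.toReal_nonneg

lemma sum_volume_mul_oscSum_le {Y : Type*} [NormedAddCommGroup Y] (f : ℝ × ℝ → Y)
    (P Q : ℝ → Finset (ℝ × ℝ × ℝ)) (P₂ : Finset (ℝ × ℝ × ℝ)) :
    ∑ y ∈ P₂, oscSum (fun s => f (s, y.1)) (P y.1) (Q y.1) * (volume (itemBox y)).toReal ≤
      ∑ z ∈ fiberProd P P₂, ∑ w ∈ fiberProd Q P₂,
        ‖f z.1 - f w.1‖ * (volume (itemBox z ∩ itemBox w)).toReal := by
  simp only [sum_fiberProd]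
  refine Finset.sum_le_sum fun y hy => ?_
  rw [oscSum, Finset.sum_mul]
  refine Finset.sum_le_sum fun x _ => ?_
  refine le_trans (le_of_eq ?_) (Finset.single_le_sum (f := fun y' => ∑ x' ∈ Q y'.1,
    ‖f (prodItem x y).1 - f (prodItem x' y').1‖ *
      (volume (itemBox (prodItem x y) ∩ itemBox (prodItem x' y'))).toReal)
    (fun _ _ => Finset.sum_nonneg fun _ _ => mul_nonneg (norm_nonneg _) ENNReal.toReal_nonneg) hy)
  rw [Finset.sum_mul]
  refine Finset.sum_congr rfl fun x' _ => ?_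
  rw [volume_itemBox_prodItem_inter, inter_self, ← mul_assoc]
  rfl

/-- The points whose section oscillates by at least `η` along fine partitions for every gauge. -/
def oscSections {Y : Type*} [NormedAddCommGroup Y] (a₁ b₁ a₂ b₂ : ℝ)
    (f : ℝ × ℝ → Y) (η : ℝ) : Set ℝ :=
  {t | t ∈ Icc a₂ b₂ ∧ ∀ δ : ℝ → ℝ, IsGauge (Icc a₁ b₁) δ →
    ∃ P Q : Finset (ℝ × ℝ × ℝ), IsMPartition (Icc a₁ b₁) P ∧ IsFine δ P ∧
      IsMPartition (Icc a₁ b₁) Q ∧ IsFine δ Q ∧ η ≤ oscSum (fun s => f (s, t)) P Q}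

lemma volume_oscSections_eq_zero {Y : Type*} [NormedAddCommGroup Y] {a₁ b₁ a₂ b₂ : ℝ}
    (hab₁ : a₁ < b₁) (hab₂ : a₂ < b₂) {f : ℝ × ℝ → Y} (hf : PropSM ((a₁, a₂) : ℝ × ℝ) (b₁, b₂) f)
    {η : ℝ} (hη : 0 < η) :
    volume (oscSections a₁ b₁ a₂ b₂ f η) = 0 := by
  classical
  set Z := oscSections a₁ b₁ a₂ b₂ f η with Z_def
  refine le_antisymm (ENNReal.le_of_forall_pos_le_add fun ε hε _ => ?_) zero_le
  rw [zero_add]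
  obtain ⟨δ, hδ, hδf⟩ := hf (η * ε) (mul_pos hη hε)
  have hδsec {t : ℝ} (ht : t ∈ Icc a₂ b₂) : IsGauge (Icc a₁ b₁) fun s => δ (s, t) :=
    fun s hs => hδ (s, t) ⟨⟨hs.1, ht.1⟩, ⟨hs.2, ht.2⟩⟩
  have hPQ (t : ℝ) : ∃ P Q : Finset (ℝ × ℝ × ℝ), t ∈ Icc a₂ b₂ →
      IsMPartition (Icc a₁ b₁) P ∧ IsFine (fun s => δ (s, t)) P ∧
      IsMPartition (Icc a₁ b₁) Q ∧ IsFine (fun s => δ (s, t)) Q ∧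
      (t ∈ Z → η ≤ oscSum (fun s => f (s, t)) P Q) := by
    by_cases ht : t ∈ Icc a₂ b₂
    · by_cases hZ : t ∈ Z
      · obtain ⟨P, Q, hP, hPδ, hQ, hQδ, h⟩ := hZ.2 _ (hδsec ht)
        exact ⟨P, Q, fun _ => ⟨hP, hPδ, hQ, hQδ, fun _ => h⟩⟩
      · obtain ⟨P, hP, hPδ⟩ := exists_isMPartition_isFine hab₁ (hδsec ht)
        exact ⟨P, P, fun _ => ⟨hP, hPδ, hP, hPδ, fun h => (hZ h).elim⟩⟩
    · exact ⟨∅, ∅, fun h => (ht h).elim⟩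
  choose P Q hPQ using hPQ
  have hδ₂ (t : ℝ) : ∃ d, t ∈ Icc a₂ b₂ → 0 < d ∧ ∀ x ∈ P t ∪ Q t, d ≤ δ (x.1, t) := by
    by_cases ht : t ∈ Icc a₂ b₂
    · obtain ⟨hP, -, hQ, -, -⟩ := hPQ t ht
      obtain ⟨d, hd, h⟩ := (P t ∪ Q t).exists_pos_forall_le (fun x => δ (x.1, t)) fun x hx =>
        hδsec ht x.1 ((Finset.mem_union.mp hx).elim (fun h => (hP.1 x h).1) fun h => (hQ.1 x h).1)
      exact ⟨d, fun _ => ⟨hd, h⟩⟩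
    · exact ⟨0, fun h => (ht h).elim⟩
  choose δ₂ hδ₂ using hδ₂
  have hZ_union : Z = ⋃ k : ℕ, {t | t ∈ Z ∧ 1 / ((k : ℝ) + 1) ≤ δ₂ t} := by
    ext t
    simp only [mem_iUnion, mem_ofPred_eq]
    refine ⟨fun ht => ?_, fun ⟨_, h⟩ => h.1⟩
    obtain ⟨k, hk⟩ := exists_nat_one_div_lt (hδ₂ t ht.1).1
    exact ⟨k, ht, hk.le⟩
  have hmono : Monotone fun k : ℕ => {t | t ∈ Z ∧ 1 / ((k : ℝ) + 1) ≤ δ₂ t} :=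
    fun k l hkl t ht => ⟨ht.1, (Nat.one_div_le_one_div hkl).trans ht.2⟩
  rw [hZ_union, hmono.measure_iUnion]
  refine iSup_le fun k => ?_
  set S := {t | t ∈ Z ∧ 1 / ((k : ℝ) + 1) ≤ δ₂ t}
  obtain ⟨P₂, hP₂, hP₂δ, hcover⟩ := exists_isMPartition_isFine_cover hab₂
    (fun t ht => (hδ₂ t ht).1) (S := S) (fun t ht => ht.1.1) Nat.one_div_pos_of_nat
    (fun t ht => ht.2)
  have htags {y : ℝ × ℝ × ℝ} (hy : y ∈ P₂) : y.1 ∈ Icc a₂ b₂ := (hP₂.1 y hy).1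
  have hlt := (sum_volume_mul_oscSum_le f P Q P₂).trans_lt <|
    hδf (fiberProd P P₂) (fiberProd Q P₂)
      (isMPartition_fiberProd (fun t ht => (hPQ t ht).1) hP₂)
      (isFine_fiberProd hP₂δ (fun y hy => (hPQ _ (htags hy)).2.1) fun y hy x hx =>
        (hδ₂ _ (htags hy)).2 x (Finset.mem_union_left _ hx))
      (isMPartition_fiberProd (fun t ht => (hPQ t ht).2.2.1) hP₂)
      (isFine_fiberProd hP₂δ (fun y hy => (hPQ _ (htags hy)).2.2.2.1) fun y hy x hx =>
        (hδ₂ _ (htags hy)).2 x (Finset.mem_union_right _ hx))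
  have hle : η * ∑ y ∈ P₂ with y.1 ∈ S, (volume (itemBox y)).toReal ≤
      ∑ y ∈ P₂, oscSum (fun s => f (s, y.1)) (P y.1) (Q y.1) * (volume (itemBox y)).toReal := by
    rw [Finset.mul_sum]
    refine (Finset.sum_le_sum fun y hy => ?_).trans
      (Finset.sum_le_sum_of_subset_of_nonneg (Finset.filter_subset _ P₂) fun y _ _ =>
        mul_nonneg (oscSum_nonneg _ _ _) ENNReal.toReal_nonneg)
    obtain ⟨hyP, hyS⟩ := Finset.mem_filter.mp hy
    exact mul_le_mul_of_nonneg_right ((hPQ _ (htags hyP)).2.2.2.2 hyS.1) ENNReal.toReal_nonneg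
  have hsum : ∑ y ∈ P₂ with y.1 ∈ S, (volume (itemBox y)).toReal ≤ ε :=
    (lt_of_mul_lt_mul_left (hle.trans_lt hlt) hη.le).le
  have hfin : ∀ y ∈ P₂.filter (fun y => y.1 ∈ S), volume (itemBox y) ≠ ⊤ :=
    fun y _ => by simp [itemBox, Real.volume_Icc]
  calc volume S ≤ volume (⋃ y ∈ P₂.filter (fun y => y.1 ∈ S), itemBox y) := by
        refine measure_mono fun s hs => ?_
        obtain ⟨y, hy, hyS, hsy⟩ := hcover s hs
        exact mem_iUnion₂.mpr ⟨y, Finset.mem_filter.mpr ⟨hy, hyS⟩, hsy⟩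
    _ ≤ ∑ y ∈ P₂ with y.1 ∈ S, volume (itemBox y) := measure_biUnion_finset_le _ _
    _ ≤ ε := by
        rw [← ENNReal.toReal_sum hfin] at hsum
        rw [← ENNReal.ofReal_coe_nnreal]
        exact (ENNReal.le_ofReal_iff_toReal_le (ENNReal.sum_ne_top.mpr hfin) ε.coe_nonneg).mpr hsum

/-- Lemma 2.3(ii): the set of `t₂` whose section fails the `𝓢*` property is null. -/
theorem indicator_badSectionsSnd_mcShane_integral_zero {X : Type*} [NormedAddCommGroup X] [NormedSpace ℝ X] [CompleteSpace X] (a₁ b₁ a₂ b₂ : ℝ) (hab₁ : a₁ < b₁) (hab₂ : a₂ < b₂)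
    (f : ℝ × ℝ → X) (hf : PropSM ((a₁, a₂) : ℝ × ℝ) (b₁, b₂) f)
    (Z₂ : Set ℝ) (hZ₂ : Z₂ = {t₂ : ℝ | t₂ ∈ Set.Icc a₂ b₂ ∧ ¬ PropSM a₁ b₁ (fun s₁ => f (s₁, t₂))}) :
    HasMcShaneIntegral (Set.Icc a₂ b₂) (Z₂.indicator (fun _ => (1 : ℝ))) 0 := by
  subst hZ₂
  refine hasMcShaneIntegral_indicator_of_null (measure_mono_null (fun t ht => ?_)
    (measure_iUnion_null fun n : ℕ => volume_oscSections_eq_zero hab₁ hab₂ hf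
      (η := 1 / ((n : ℝ) + 1)) Nat.one_div_pos_of_nat))
  obtain ⟨ht, hbad⟩ := ht
  unfold PropSM at hbad
  push Not at hbad
  obtain ⟨ε, hε, hbad⟩ := hbad
  obtain ⟨n, hn⟩ := exists_nat_one_div_lt hε
  refine mem_iUnion.mpr ⟨n, ht, fun δ hδ => ?_⟩
  obtain ⟨P, Q, hP, hPδ, hQ, hQδ, h⟩ := hbad δ hδ
  exact ⟨P, Q, hP, hPδ, hQ, hQδ, hn.le.trans h⟩
end

section
/- Let f : [a,b] → X have the property S*HK on [a,b] and let Z₁ = { t₁ ∈ [a₁,b₁] : the section f_{t₁} does not have the property S*HK on [a₂,b₂] }. Then the indicator function 𝟙_{Z₁} is Henstock–Kurzweil integrable on [a₁,b₁] with (HK)∫_{[a₁,b₁]} 𝟙_{Z₁} = 0. -/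
open Set MeasureTheory

variable {E : Type*} [MeasureSpace E] [PseudoMetricSpace E] [Preorder E]
variable {X : Type*} [NormedAddCommGroup X] [NormedSpace ℝ X]

open scoped Classical in
/-- Partitioning every interval of a partition gives a partition. -/
theorem IsHKPartition.biUnion {F : Type*} [PseudoMetricSpace F] [Preorder F] {K : Set F}
    {P : Finset (F × F × F)} {R : F × F × F → Finset (F × F × F)} (hP : IsMPartition K P)
    (hR : ∀ x ∈ P, IsHKPartition (itemBox x) (R x)) : IsHKPartition K (P.biUnion R) := by
  obtain ⟨hsub, hdisj, hcov⟩ := hP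
  have hbox : ∀ x ∈ P, itemBox x ⊆ K := fun x hx => (hsub x hx).2.1
  refine ⟨⟨?_, ?_, ?_⟩, ?_⟩
  · intro y hy
    obtain ⟨x, hx, hy⟩ := Finset.mem_biUnion.1 hy
    obtain ⟨h1, h2, h3⟩ := (hR x hx).1.1 y hy
    exact ⟨hbox x hx h1, h2.trans (hbox x hx), h3⟩
  · intro y hy y' hy' hne
    obtain ⟨x, hx, hy⟩ := Finset.mem_biUnion.1 hy
    obtain ⟨x', hx', hy'⟩ := Finset.mem_biUnion.1 hy'
    by_cases hxx : x = x'
    · subst hxx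
      exact (hR x hx).1.2.1 y hy y' hy' hne
    · refine subset_empty_iff.1 (subset_trans (inter_subset_inter ?_ ?_)
        (hdisj x hx x' hx' hxx).subset)
      · exact interior_mono ((hR x hx).1.1 y hy).2.1
      · exact interior_mono ((hR x' hx').1.1 y' hy').2.1
  · rw [Finset.set_biUnion_biUnion, ← hcov]
    exact iUnion₂_congr fun x hx => (hR x hx).1.2.2
  · intro y hy
    obtain ⟨x, hx, hy⟩ := Finset.mem_biUnion.1 hy
    exact (hR x hx).2 y hy

theorem isHKPartition_singleton {F : Type*} [PseudoMetricSpace F] [Preorder F]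
    {x : F × F × F} (hx : x.1 ∈ itemBox x)
    (hint : (interior (itemBox x)).Nonempty) : IsHKPartition (itemBox x) {x} := by
  refine ⟨⟨?_, ?_, by simp⟩, by simpa using hx⟩
  · intro y hy
    obtain rfl := Finset.mem_singleton.1 hy
    exact ⟨hx, Subset.rfl, hint⟩
  · intro y hy z hz hne
    exact absurd ((Finset.mem_singleton.1 hy).trans (Finset.mem_singleton.1 hz).symm) hne

open scoped Classical in
theorem IsHKPartition.union_Icc {a b c : ℝ} (hab : a < b) (hbc : b < c)
    {P Q : Finset (ℝ × ℝ × ℝ)} (hP : IsHKPartition (Icc a b) P)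
    (hQ : IsHKPartition (Icc b c) Q) : IsHKPartition (Icc a c) (P ∪ Q) := by
  have hne : ((a, a, b) : ℝ × ℝ × ℝ) ≠ (b, b, c) := fun h => hab.ne (congrArg Prod.fst h)
  have hM : IsMPartition (Icc a c) {((a, a, b) : ℝ × ℝ × ℝ), (b, b, c)} := by
    refine ⟨?_, ?_, ?_⟩
    · simp only [Finset.mem_insert, Finset.mem_singleton, forall_eq_or_imp, forall_eq,
        IsSubinterval, interior_Icc, nonempty_Ioo]
      exact ⟨⟨⟨le_rfl, (hab.trans hbc).le⟩, Icc_subset_Icc_right hbc.le, hab⟩,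
        ⟨hab.le, hbc.le⟩, Icc_subset_Icc_left hab.le, hbc⟩
    · have key : Ioo a b ∩ Ioo b c = ∅ := by
        ext x
        simp only [mem_inter_iff, mem_Ioo, mem_empty_iff_false, iff_false]
        intro h
        linarith [h.1.2, h.2.1]
      intro x hx y hy hxy
      simp only [Finset.mem_insert, Finset.mem_singleton] at hx hy
      rcases hx with rfl | rfl <;> rcases hy with rfl | rfl
      · exact absurd rfl hxy
      · simpa [itemBox] using key
      · simpa [itemBox, inter_comm] using key
      · exact absurd rfl hxy
    · simp [itemBox, Icc_union_Icc_eq_Icc hab.le hbc.le]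
  have h := IsHKPartition.biUnion (R := fun x => if x = (a, a, b) then P else Q) hM (by
    simp only [Finset.mem_insert, Finset.mem_singleton, forall_eq_or_imp, forall_eq, if_true,
      hne.symm, if_false]
    exact ⟨hP, hQ⟩)
  simpa [Finset.biUnion_insert, hne.symm] using h

/-- Cousin's lemma: every gauge on a compact interval admits a fine partition. -/
theorem exists_isHKPartition_isFine {a b : ℝ} (hab : a < b) {δ : ℝ → ℝ}
    (hδ : IsGauge (Icc a b) δ) :
    ∃ P : Finset (ℝ × ℝ × ℝ), IsHKPartition (Icc a b) P ∧ IsFine δ P := by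
  classical
  let p : ℝ → ℝ → Prop := fun u v =>
    u < v → ∃ P : Finset (ℝ × ℝ × ℝ), IsHKPartition (Icc u v) P ∧ IsFine δ P
  have hadd : ∀ {u v w}, u ≤ v → v ≤ w → p u v → p v w → p u w := by
    intro u v w huv hvw h1 h2
    rcases huv.eq_or_lt with rfl | huv
    · exact h2
    rcases hvw.eq_or_lt with rfl | hvw
    · exact h1
    intro _
    obtain ⟨P, hP, hPf⟩ := h1 huv
    obtain ⟨Q, hQ, hQf⟩ := h2 hvw
    refine ⟨P ∪ Q, hP.union_Icc huv hvw hQ, fun x hx => ?_⟩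
    rcases Finset.mem_union.1 hx with hx | hx
    · exact hPf x hx
    · exact hQf x hx
  have hloc : ∀ {t u v}, u ≤ t → t ≤ v → t - δ t < u → v < t + δ t → p u v := by
    intro t u v hut htv hu hv huv
    have hx : t ∈ itemBox (t, u, v) := ⟨hut, htv⟩
    refine ⟨{(t, u, v)}, isHKPartition_singleton hx (by simpa [itemBox] using huv), ?_⟩
    intro y hy
    obtain rfl := Finset.mem_singleton.1 hy
    rw [Real.ball_eq_Ioo]
    exact Icc_subset_Ioo hu hv
  let S : Set ℝ := {x | x ∈ Icc a b ∧ p a x}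
  have haS : a ∈ S := ⟨⟨le_rfl, hab.le⟩, fun h => absurd h (lt_irrefl a)⟩
  have hbdd : BddAbove S := ⟨b, fun x hx => hx.1.2⟩
  have hac : a ≤ sSup S := le_csSup hbdd haS
  have hcb : sSup S ≤ b := csSup_le ⟨a, haS⟩ fun x hx => hx.1.2
  have hδc : 0 < δ (sSup S) := hδ _ ⟨hac, hcb⟩
  obtain ⟨x, hxS, hx⟩ := exists_lt_of_lt_csSup ⟨a, haS⟩ (sub_lt_self (sSup S) hδc)
  have hxc : x ≤ sSup S := le_csSup hbdd hxS
  obtain ⟨y, hcy, hyb, hyδ, hy⟩ :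
      ∃ y, sSup S ≤ y ∧ y ≤ b ∧ y < sSup S + δ (sSup S) ∧ (y = b ∨ sSup S < y) := by
    rcases hcb.eq_or_lt with h | h
    · exact ⟨b, hcb, le_rfl, by linarith, Or.inl rfl⟩
    · have h' : sSup S < min b (sSup S + δ (sSup S) / 2) := lt_min h (by linarith)
      exact ⟨_, h'.le, min_le_left _ _, (min_le_right _ _).trans_lt (by linarith), Or.inr h'⟩
  have hyS : p a y := hadd hxS.1.1 (hxc.trans hcy) hxS.2 (hloc hxc hcy hx hyδ)
  rcases hy with rfl | hy
  · exact hyS hab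
  · exact absurd (le_csSup hbdd (show y ∈ S from ⟨⟨hac.trans hcy, hyb⟩, hyS⟩)) hy.not_ge

/-- The terms of the Riemann sum of an indicator are nonnegative. -/
theorem indicator_term_nonneg (Z : Set ℝ) (x : ℝ × ℝ × ℝ) :
    0 ≤ (volume (itemBox x)).toReal • Z.indicator (fun _ => (1 : ℝ)) x.1 :=
  smul_nonneg ENNReal.toReal_nonneg (indicator_nonneg (fun _ _ => zero_le_one) _)

/-- Saks–Henstock lemma for indicators: a bound valid for all fine partitions is valid for
all fine subfamilies of partitions. -/
theorem sum_indicator_lt_of_isFine_subset {a b ε : ℝ} {Z : Set ℝ} {δ : ℝ → ℝ}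
    (hδ : IsGauge (Icc a b) δ)
    (h : ∀ P : Finset (ℝ × ℝ × ℝ), IsHKPartition (Icc a b) P → IsFine δ P →
      ∑ x ∈ P, (volume (itemBox x)).toReal • Z.indicator (fun _ => (1 : ℝ)) x.1 < ε)
    {P P' : Finset (ℝ × ℝ × ℝ)} (hP : IsHKPartition (Icc a b) P) (hP' : P' ⊆ P)
    (hfine : IsFine δ P') :
    ∑ x ∈ P', (volume (itemBox x)).toReal • Z.indicator (fun _ => (1 : ℝ)) x.1 < ε := by
  classical
  have hex : ∀ x ∈ P, ∃ Q, IsHKPartition (itemBox x) Q ∧ IsFine δ Q ∧ (x ∈ P' → x ∈ Q) := by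
    intro x hx
    have hsub := (hP.1.1 x hx).2
    by_cases hxP : x ∈ P'
    · refine ⟨{x}, isHKPartition_singleton (hP.2 x hx) hsub.2, ?_, by simp⟩
      intro y hy
      obtain rfl := Finset.mem_singleton.1 hy
      exact hfine y hxP
    · have hlt : x.2.1 < x.2.2 := by simpa using hsub.2
      obtain ⟨Q, hQ, hQf⟩ := exists_isHKPartition_isFine hlt
        (δ := δ) fun t ht => hδ t (hsub.1 ht)
      exact ⟨Q, hQ, hQf, fun h => absurd h hxP⟩
  choose! R hR hRf hRm using hex
  refine lt_of_le_of_lt ?_ (h (P.biUnion R) (IsHKPartition.biUnion hP.1 hR) ?_)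
  · exact Finset.sum_le_sum_of_subset_of_nonneg
      (fun x hx => Finset.mem_biUnion.2 ⟨x, hP' hx, hRm x (hP' hx) hx⟩)
      fun x _ _ => indicator_term_nonneg Z x
  · intro y hy
    obtain ⟨x, hx, hy⟩ := Finset.mem_biUnion.1 hy
    exact hRf x hx y hy

theorem hasHKIntegral_indicator_zero_iff {a b : ℝ} {Z : Set ℝ} :
    HasHKIntegral (Icc a b) (Z.indicator (fun _ => (1 : ℝ))) 0 ↔
      ∀ ε > 0, ∃ δ : ℝ → ℝ, IsGauge (Icc a b) δ ∧
        ∀ P : Finset (ℝ × ℝ × ℝ), IsHKPartition (Icc a b) P → IsFine δ P →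
          ∑ x ∈ P, (volume (itemBox x)).toReal • Z.indicator (fun _ => (1 : ℝ)) x.1 < ε := by
  have hnorm : ∀ P : Finset (ℝ × ℝ × ℝ),
      ‖(∑ x ∈ P, (volume (itemBox x)).toReal • Z.indicator (fun _ => (1 : ℝ)) x.1) - 0‖ =
        ∑ x ∈ P, (volume (itemBox x)).toReal • Z.indicator (fun _ => (1 : ℝ)) x.1 := by
    intro P
    rw [sub_zero, Real.norm_of_nonneg (Finset.sum_nonneg fun x _ => indicator_term_nonneg Z x)]
  simp only [HasHKIntegral, hnorm]

/-- A countable union of sets whose indicators have integral zero has the same property. -/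
theorem hasHKIntegral_indicator_iUnion {a b : ℝ} {Z : ℕ → Set ℝ}
    (hZ : ∀ n, HasHKIntegral (Icc a b) ((Z n).indicator (fun _ => (1 : ℝ))) 0) :
    HasHKIntegral (Icc a b) ((⋃ n, Z n).indicator (fun _ => (1 : ℝ))) 0 := by
  classical
  rw [hasHKIntegral_indicator_zero_iff]
  intro ε hε
  obtain ⟨ε', hε', c, hc, hcε⟩ := posSumOfEncodable (half_pos hε) ℕ
  choose δ hδ h using fun n => hasHKIntegral_indicator_zero_iff.1 (hZ n) (ε' n) (hε' n)
  have hex : ∀ t, ∃ n, t ∈ (⋃ n, Z n) → t ∈ Z n := by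
    intro t
    by_cases ht : t ∈ ⋃ n, Z n
    · obtain ⟨n, hn⟩ := mem_iUnion.1 ht
      exact ⟨n, fun _ => hn⟩
    · exact ⟨0, fun h => absurd h ht⟩
  choose N hN using hex
  refine ⟨fun t => δ (N t) t, fun t ht => hδ (N t) t ht, fun P hP hPf => ?_⟩
  rw [← Finset.sum_fiberwise_of_maps_to
    (fun x hx => Finset.mem_image_of_mem (fun x : ℝ × ℝ × ℝ => N x.1) hx)]
  calc _ ≤ ∑ n ∈ P.image (fun x => N x.1), ε' n := by
        refine Finset.sum_le_sum fun n _ => ?_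
        refine le_trans (Finset.sum_le_sum fun x hx => ?_)
          (sum_indicator_lt_of_isFine_subset (hδ n) (h n) hP
            (Finset.filter_subset (fun x => N x.1 = n) P) ?_).le
        · refine smul_le_smul_of_nonneg_left ?_ ENNReal.toReal_nonneg
          by_cases hx' : x.1 ∈ ⋃ n, Z n
          · have := hN x.1 hx'
            rw [(Finset.mem_filter.1 hx).2] at this
            rw [indicator_of_mem hx', indicator_of_mem this]
          · rw [indicator_of_notMem hx']
            exact indicator_nonneg (fun _ _ => zero_le_one) _
        · intro x hx
          obtain ⟨hxP, rfl⟩ := Finset.mem_filter.1 hx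
          exact hPf x hxP
    _ ≤ c := sum_le_hasSum _ (fun n _ => (hε' n).le) hc
    _ < ε := by linarith

/-- The product of two tagged intervals, as a tagged rectangle. -/
def itemProd (z : Σ _ : ℝ × ℝ × ℝ, ℝ × ℝ × ℝ) : (ℝ × ℝ) × (ℝ × ℝ) × (ℝ × ℝ) :=
  ((z.1.1, z.2.1), (z.1.2.1, z.2.2.1), (z.1.2.2, z.2.2.2))

theorem itemProd_injective : Function.Injective itemProd := by
  rintro ⟨⟨t, p, q⟩, s, u, v⟩ ⟨⟨t', p', q'⟩, s', u', v'⟩ h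
  simp only [itemProd, Prod.mk.injEq] at h
  obtain ⟨⟨rfl, rfl⟩, ⟨rfl, rfl⟩, rfl, rfl⟩ := h
  rfl

theorem itemBox_itemProd (z : Σ _ : ℝ × ℝ × ℝ, ℝ × ℝ × ℝ) :
    itemBox (itemProd z) = itemBox z.1 ×ˢ itemBox z.2 := by
  simp [itemBox, itemProd, Icc_prod_Icc]

/-- The tagged rectangles over the items of `P`, with second sides from `R`. -/
def prodPartition (P : Finset (ℝ × ℝ × ℝ)) (R : ℝ → Finset (ℝ × ℝ × ℝ)) :
    Finset ((ℝ × ℝ) × (ℝ × ℝ) × (ℝ × ℝ)) :=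
  (P.sigma fun x => R x.1).map ⟨itemProd, itemProd_injective⟩

theorem mem_prodPartition {P : Finset (ℝ × ℝ × ℝ)} {R : ℝ → Finset (ℝ × ℝ × ℝ)}
    {w : (ℝ × ℝ) × (ℝ × ℝ) × (ℝ × ℝ)} :
    w ∈ prodPartition P R ↔ ∃ x ∈ P, ∃ y ∈ R x.1, itemProd ⟨x, y⟩ = w := by
  simp only [prodPartition, Finset.mem_map, Finset.mem_sigma, Function.Embedding.coeFn_mk]
  constructor
  · rintro ⟨⟨x, y⟩, ⟨hx, hy⟩, rfl⟩
    exact ⟨x, hx, y, hy, rfl⟩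
  · rintro ⟨x, hx, y, hy, rfl⟩
    exact ⟨⟨x, y⟩, ⟨hx, hy⟩, rfl⟩

theorem IsHKPartition.prodPartition {a₁ b₁ a₂ b₂ : ℝ} {P : Finset (ℝ × ℝ × ℝ)}
    {R : ℝ → Finset (ℝ × ℝ × ℝ)} (hP : IsHKPartition (Icc a₁ b₁) P)
    (hR : ∀ t ∈ Icc a₁ b₁, IsHKPartition (Icc a₂ b₂) (R t)) :
    IsHKPartition (Icc ((a₁, a₂) : ℝ × ℝ) (b₁, b₂)) (prodPartition P R) := by
  have hR' : ∀ x ∈ P, IsHKPartition (Icc a₂ b₂) (R x.1) := fun x hx => hR _ (hP.1.1 x hx).1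
  rw [← Icc_prod_Icc]
  refine ⟨⟨?_, ?_, ?_⟩, ?_⟩
  · intro w hw
    obtain ⟨x, hx, y, hy, rfl⟩ := mem_prodPartition.1 hw
    obtain ⟨hx1, hx2, hx3⟩ := hP.1.1 x hx
    obtain ⟨hy1, hy2, hy3⟩ := (hR' x hx).1.1 y hy
    refine ⟨⟨hx1, hy1⟩, ?_⟩
    change itemBox (itemProd ⟨x, y⟩) ⊆ _ ∧ (interior (itemBox (itemProd ⟨x, y⟩))).Nonempty
    rw [itemBox_itemProd, interior_prod_eq]
    exact ⟨prod_mono hx2 hy2, hx3.prod hy3⟩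
  · intro w hw w' hw' hne
    obtain ⟨x, hx, y, hy, rfl⟩ := mem_prodPartition.1 hw
    obtain ⟨x', hx', y', hy', rfl⟩ := mem_prodPartition.1 hw'
    rw [itemBox_itemProd, itemBox_itemProd, interior_prod_eq, interior_prod_eq, prod_inter_prod,
      prod_eq_empty_iff]
    by_cases hxx : x = x'
    · subst hxx
      exact Or.inr ((hR' x hx).1.2.1 y hy y' hy' fun h => hne (by rw [h]))
    · exact Or.inl (hP.1.2.1 x hx x' hx' hxx)
  · ext ⟨t, s⟩
    simp only [mem_iUnion, exists_prop, mem_prodPartition]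
    constructor
    · rintro ⟨_, ⟨x, hx, y, hy, rfl⟩, hw⟩
      rw [itemBox_itemProd] at hw
      exact ⟨(hP.1.1 x hx).2.1 hw.1, ((hR' x hx).1.1 y hy).2.1 hw.2⟩
    · rintro ⟨ht, hs⟩
      rw [← hP.1.2.2] at ht
      obtain ⟨x, hx, hxt⟩ := mem_iUnion₂.1 ht
      rw [← (hR' x hx).1.2.2] at hs
      obtain ⟨y, hy, hys⟩ := mem_iUnion₂.1 hs
      exact ⟨_, ⟨x, hx, y, hy, rfl⟩, by rw [itemBox_itemProd]; exact ⟨hxt, hys⟩⟩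
  · intro w hw
    obtain ⟨x, hx, y, hy, rfl⟩ := mem_prodPartition.1 hw
    rw [itemBox_itemProd]
    exact ⟨hP.2 x hx, (hR' x hx).2 y hy⟩

theorem IsFine.prodPartition {P : Finset (ℝ × ℝ × ℝ)} {R : ℝ → Finset (ℝ × ℝ × ℝ)}
    {δ : ℝ × ℝ → ℝ} {r : ℝ → ℝ} (hP : IsFine r P)
    (hR : ∀ x ∈ P, IsFine (fun s => δ (x.1, s)) (R x.1))
    (hr : ∀ x ∈ P, ∀ y ∈ R x.1, r x.1 ≤ δ (x.1, y.1)) : IsFine δ (prodPartition P R) := by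
  intro w hw
  obtain ⟨x, hx, y, hy, rfl⟩ := mem_prodPartition.1 hw
  rw [itemBox_itemProd]
  change _ ⊆ Metric.ball (x.1, y.1) (δ (x.1, y.1))
  rw [← ball_prod_same]
  exact prod_mono ((hP x hx).trans (Metric.ball_subset_ball (hr x hx y hy))) (hR x hx y hy)

theorem sum_prodPartition {P : Finset (ℝ × ℝ × ℝ)} {R : ℝ → Finset (ℝ × ℝ × ℝ)}
    (g : (ℝ × ℝ) × (ℝ × ℝ) × (ℝ × ℝ) → ℝ) :
    ∑ w ∈ prodPartition P R, g w = ∑ x ∈ P, ∑ y ∈ R x.1, g (itemProd ⟨x, y⟩) := by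
  simp [prodPartition, Finset.sum_sigma]

/-- The double sum over two partitions into rectangles dominates the integral of the double sums
over the sections. -/
theorem sum_section_le_sum_prodPartition {Y : Type*} [NormedAddCommGroup Y] (f : ℝ × ℝ → Y)
    (P : Finset (ℝ × ℝ × ℝ))
    (R R' : ℝ → Finset (ℝ × ℝ × ℝ)) :
    ∑ x ∈ P, (volume (itemBox x)).toReal *
        ∑ y ∈ R x.1, ∑ y' ∈ R' x.1,
          ‖f (x.1, y.1) - f (x.1, y'.1)‖ * (volume (itemBox y ∩ itemBox y')).toReal ≤
      ∑ w ∈ prodPartition P R, ∑ w' ∈ prodPartition P R',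
        ‖f w.1 - f w'.1‖ * (volume (itemBox w ∩ itemBox w')).toReal := by
  rw [sum_prodPartition]
  refine Finset.sum_le_sum fun x hx => ?_
  rw [Finset.mul_sum]
  refine Finset.sum_le_sum fun y _ => ?_
  rw [sum_prodPartition]
  refine le_trans (le_of_eq ?_) (Finset.single_le_sum (fun x' _ => Finset.sum_nonneg fun y' _ =>
    mul_nonneg (norm_nonneg _) ENNReal.toReal_nonneg) hx)
  rw [Finset.mul_sum]
  refine Finset.sum_congr rfl fun y' _ => ?_
  rw [itemBox_itemProd, itemBox_itemProd, prod_inter_prod, inter_self, Measure.volume_eq_prod,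
    Measure.prod_prod, ENNReal.toReal_mul]
  simp only [itemProd]
  ring

/-- The points of `[a₁, b₁]` whose sections have double sums at least `η` for every gauge form
a set whose indicator has integral zero. -/
theorem hasHKIntegral_indicator_section_double_sum_ge {Y : Type*} [NormedAddCommGroup Y]
    {a₁ b₁ a₂ b₂ η : ℝ} (hab₂ : a₂ < b₂) {f : ℝ × ℝ → Y}
    (hf : PropSHK ((a₁, a₂) : ℝ × ℝ) (b₁, b₂) f) (hη : 0 < η) {Z : Set ℝ}
    (hZ : ∀ t ∈ Z, ∀ δ : ℝ → ℝ, IsGauge (Icc a₂ b₂) δ → ∃ P Q : Finset (ℝ × ℝ × ℝ),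
      IsHKPartition (Icc a₂ b₂) P ∧ IsFine δ P ∧ IsHKPartition (Icc a₂ b₂) Q ∧ IsFine δ Q ∧
      η ≤ ∑ x ∈ P, ∑ y ∈ Q,
        ‖f (t, x.1) - f (t, y.1)‖ * (volume (itemBox x ∩ itemBox y)).toReal) :
    HasHKIntegral (Icc a₁ b₁) (Z.indicator (fun _ => (1 : ℝ))) 0 := by
  classical
  rw [hasHKIntegral_indicator_zero_iff]
  intro ε hε
  obtain ⟨δ, hδ, h⟩ := hf (ε * η) (mul_pos hε hη)
  have hδ' : ∀ t ∈ Icc a₁ b₁, IsGauge (Icc a₂ b₂) fun s => δ (t, s) := fun t ht s hs =>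
    hδ _ ⟨⟨ht.1, hs.1⟩, ht.2, hs.2⟩
  have hex : ∀ t ∈ Icc a₁ b₁, ∃ P Q : Finset (ℝ × ℝ × ℝ),
      IsHKPartition (Icc a₂ b₂) P ∧ IsFine (fun s => δ (t, s)) P ∧
      IsHKPartition (Icc a₂ b₂) Q ∧ IsFine (fun s => δ (t, s)) Q ∧
      (t ∈ Z → η ≤ ∑ x ∈ P, ∑ y ∈ Q,
        ‖f (t, x.1) - f (t, y.1)‖ * (volume (itemBox x ∩ itemBox y)).toReal) := by
    intro t ht
    by_cases htZ : t ∈ Z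
    · obtain ⟨P, Q, hP, hPf, hQ, hQf, hPQ⟩ := hZ t htZ _ (hδ' t ht)
      exact ⟨P, Q, hP, hPf, hQ, hQf, fun _ => hPQ⟩
    · obtain ⟨P, hP, hPf⟩ := exists_isHKPartition_isFine hab₂ (hδ' t ht)
      exact ⟨P, P, hP, hPf, hP, hPf, fun h => absurd h htZ⟩
  choose! R R' hR hRf hR' hRf' hsum using hex
  have hrex : ∀ t ∈ Icc a₁ b₁, ∃ r > 0, ∀ y ∈ R t ∪ R' t, r ≤ δ (t, y.1) := by
    intro t ht
    have hpos : ∀ y ∈ R t ∪ R' t, 0 < δ (t, y.1) := by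
      intro y hy
      rcases Finset.mem_union.1 hy with hy | hy
      · exact hδ' t ht _ ((hR t ht).1.1 y hy).1
      · exact hδ' t ht _ ((hR' t ht).1.1 y hy).1
    rcases (R t ∪ R' t).eq_empty_or_nonempty with he | hne
    · exact ⟨1, one_pos, by simp [he]⟩
    · exact ⟨(R t ∪ R' t).inf' hne fun y => δ (t, y.1), (Finset.lt_inf'_iff hne).2 hpos,
        fun y hy => Finset.inf'_le _ hy⟩
  choose! r hr hrle using hrex
  refine ⟨r, hr, fun P hP hPf => ?_⟩
  have hPK : ∀ x ∈ P, x.1 ∈ Icc a₁ b₁ := fun x hx => (hP.1.1 x hx).1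
  have hlt := (sum_section_le_sum_prodPartition f P R R').trans_lt
    (h _ _ (hP.prodPartition hR)
      (hPf.prodPartition (fun x hx => hRf _ (hPK x hx)) fun x hx y hy =>
        hrle _ (hPK x hx) y (Finset.mem_union_left _ hy))
      (hP.prodPartition hR')
      (hPf.prodPartition (fun x hx => hRf' _ (hPK x hx)) fun x hx y hy =>
        hrle _ (hPK x hx) y (Finset.mem_union_right _ hy)))
  refine lt_of_mul_lt_mul_right (lt_of_le_of_lt ?_ hlt) hη.le
  rw [Finset.sum_mul]
  refine Finset.sum_le_sum fun x hx => ?_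
  rw [smul_eq_mul, mul_assoc]
  refine mul_le_mul_of_nonneg_left ?_ ENNReal.toReal_nonneg
  by_cases hxZ : x.1 ∈ Z
  · simpa [hxZ] using hsum _ (hPK x hx) hxZ
  · rw [indicator_of_notMem hxZ, zero_mul]
    exact Finset.sum_nonneg fun y _ => Finset.sum_nonneg fun y' _ =>
      mul_nonneg (norm_nonneg _) ENNReal.toReal_nonneg

/-- Lemma 2.3(i): the set of `t₁` whose section fails the `𝓢*` property is null
(its indicator is integrable with integral `0`). -/
theorem indicator_badSectionsFst_hk_integral_zero {X : Type*} [NormedAddCommGroup X] [NormedSpace ℝ X] [CompleteSpace X] (a₁ b₁ a₂ b₂ : ℝ) (hab₁ : a₁ < b₁) (hab₂ : a₂ < b₂)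
    (f : ℝ × ℝ → X) (hf : PropSHK ((a₁, a₂) : ℝ × ℝ) (b₁, b₂) f)
    (Z₁ : Set ℝ) (hZ₁ : Z₁ = {t₁ : ℝ | t₁ ∈ Set.Icc a₁ b₁ ∧ ¬ PropSHK a₂ b₂ (fun s₂ => f (t₁, s₂))}) :
    HasHKIntegral (Set.Icc a₁ b₁) (Z₁.indicator (fun _ => (1 : ℝ))) 0 := by
  let Z : ℕ → Set ℝ := fun n => {t | t ∈ Icc a₁ b₁ ∧ ∀ δ : ℝ → ℝ, IsGauge (Icc a₂ b₂) δ →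
    ∃ P Q : Finset (ℝ × ℝ × ℝ), IsHKPartition (Icc a₂ b₂) P ∧ IsFine δ P ∧
      IsHKPartition (Icc a₂ b₂) Q ∧ IsFine δ Q ∧
      1 / ((n : ℝ) + 1) ≤ ∑ x ∈ P, ∑ y ∈ Q,
        ‖f (t, x.1) - f (t, y.1)‖ * (volume (itemBox x ∩ itemBox y)).toReal}
  have hZ : Z₁ = ⋃ n, Z n := by
    rw [hZ₁]
    ext t
    rw [mem_iUnion]
    constructor
    · rintro ⟨ht, h⟩
      simp only [PropSHK] at h
      push Not at h
      obtain ⟨ε, hε, h⟩ := h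
      obtain ⟨n, hn⟩ := exists_nat_one_div_lt hε
      refine ⟨n, ht, fun δ hδ => ?_⟩
      obtain ⟨P, Q, hP, hPf, hQ, hQf, hPQ⟩ := h δ hδ
      exact ⟨P, Q, hP, hPf, hQ, hQf, hn.le.trans hPQ⟩
    · rintro ⟨n, ht, hn⟩
      refine ⟨ht, fun h => ?_⟩
      obtain ⟨δ, hδ, h⟩ := h (1 / ((n : ℝ) + 1)) Nat.one_div_pos_of_nat
      obtain ⟨P, Q, hP, hPf, hQ, hQf, hPQ⟩ := hn δ hδ
      exact (h P Q hP hPf hQ hQf).not_ge hPQ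
  rw [hZ]
  exact hasHKIntegral_indicator_iUnion fun n =>
    hasHKIntegral_indicator_section_double_sum_ge hab₂ hf Nat.one_div_pos_of_nat fun t ht => ht.2
end
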